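/- arXiv:2309.10968 — 7 statements merged into one kernel-verified Lean document; each statement's English description precedes it below -/
import Mathlib

section
/- Let X be a finite type and let Ch : Finset X → Finset X be a choice function satisfying: (contraction) Ch(Y) ⊆ Y for every Y; (substitutability) for all Y' ⊆ Y, Y' \ Ch(Y') ⊆ Y \ Ch(Y); and (law of aggregate demand) for all Y' ⊆ Y, |Ch(Y')| ≤ |Ch(Y)|. Then for all Y₁, Y₂ ⊆ X with Y₁ ∩ Y₂ = ∅, one has Ch(Y₁ ∪ Y₂) = Ch(Y₁ ∪ Ch(Y₂)). -/
/-- For a choice function `Ch` on a finite type `X` satisfying contraction,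
substitutability and the law of aggregate demand, the order of application is irrelevant:
`Ch (Y₁ ∪ Y₂) = Ch (Y₁ ∪ Ch Y₂)` whenever `Y₁ ∩ Y₂ = ∅`. -/
theorem choice_order_irrelevant {X : Type*} [Fintype X] [DecidableEq X]
    (Ch : Finset X → Finset X)
    (hcontr : ∀ Y : Finset X, Ch Y ⊆ Y)
    (hsubst : ∀ Y' Y : Finset X, Y' ⊆ Y → Y' \ Ch Y' ⊆ Y \ Ch Y)
    (hlad : ∀ Y' Y : Finset X, Y' ⊆ Y → (Ch Y').card ≤ (Ch Y).card)
    (Y₁ Y₂ : Finset X) (hdisj : Y₁ ∩ Y₂ = ∅) :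
    Ch (Y₁ ∪ Y₂) = Ch (Y₁ ∪ Ch Y₂) := by
  have hsub : Y₁ ∪ Ch Y₂ ⊆ Y₁ ∪ Y₂ := Finset.union_subset_union_right (hcontr Y₂)
  refine Finset.eq_of_subset_of_card_le (fun x hx => ?_) (hlad _ _ hsub)
  have not_rejected {Y : Finset X} (hY : Y ⊆ Y₁ ∪ Y₂) (hxY : x ∈ Y) : x ∈ Ch Y := by
    by_contra hxCh
    exact (Finset.mem_sdiff.mp (hsubst _ _ hY (Finset.mem_sdiff.mpr ⟨hxY, hxCh⟩))).2 hx
  refine not_rejected hsub ?_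
  rcases Finset.mem_union.mp (hcontr _ hx) with h | h
  · exact Finset.mem_union_left _ h
  · exact Finset.mem_union_right _ (not_rejected Finset.subset_union_right h)
end

section
/- Let F ⊆ (Fin m → ℕ) be hereditary and an M♮-convex set, let X be a finite set of contracts with a map col : X → Fin m, let w : X → ℝ be injective with w(x) > 0 for all x, and let Y' ⊆ X' ⊆ X with Y' feasible. Then the following are equivalent: (i) w(Y') ≥ w(Z) for every feasible Z ⊆ X' (Y' is an optimal solution of max_{Y ⊆ X', Y feasible} w(Y)); (ii) for each x ∈ X' \ Y', both (a) Y' ∪ {x} is infeasible, and (b) for every y ∈ Y', if (Y' ∪ {x}) \ {y} is feasible then w(y) > w(x). -/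
/-- The `i`-th standard unit vector in `ℕ^m`. -/
def chi {m : ℕ} (i : Fin m) : Fin m → ℕ := fun j => if j = i then 1 else 0

/-- A family `F ⊆ ℕ^m` is hereditary if it contains `0` and is downward closed
with respect to the componentwise order. -/
def Hereditary {m : ℕ} (F : Set (Fin m → ℕ)) : Prop :=
  (0 : Fin m → ℕ) ∈ F ∧ ∀ ν ∈ F, ∀ ν' : Fin m → ℕ, ν' ≤ ν → ν' ∈ F

/-- `F ⊆ ℕ^m` is an M♮-convex set: for all `ν, ν' ∈ F` and every index `i` with
`ν i > ν' i`, either (`ν − χᵢ ∈ F` and `ν' + χᵢ ∈ F`) or there exists `j` with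
`ν j < ν' j` such that `ν − χᵢ + χⱼ ∈ F` and `ν' + χᵢ − χⱼ ∈ F`. -/
def MNatConvex {m : ℕ} (F : Set (Fin m → ℕ)) : Prop :=
  ∀ ν ∈ F, ∀ ν' ∈ F, ∀ i : Fin m, ν' i < ν i →
    ((ν - chi i ∈ F ∧ ν' + chi i ∈ F) ∨
      ∃ j : Fin m, ν j < ν' j ∧ ν - chi i + chi j ∈ F ∧ ν' + chi i - chi j ∈ F)

/-- The vector of numbers of contracts in `Y` assigned to each college. -/
def nu {ι : Type*} [DecidableEq ι] {m : ℕ} (col : ι → Fin m) (Y : Finset ι) :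
    Fin m → ℕ := fun i => (Y.filter (fun x => col x = i)).card

section Feasibility

variable {m : ℕ} {ι : Type*} [DecidableEq ι]

theorem nu_insert (col : ι → Fin m) {Y : Finset ι} {x : ι} (hx : x ∉ Y) :
    nu col (insert x Y) = nu col Y + chi (col x) := by
  funext i
  simp only [nu, chi, Pi.add_apply, Finset.filter_insert]
  by_cases h : col x = i
  · simp [h, hx]
  · simp [h, Ne.symm h]

theorem nu_erase (col : ι → Fin m) {Y : Finset ι} {y : ι} (hy : y ∈ Y) :
    nu col (Y.erase y) = nu col Y - chi (col y) := by
  have h := nu_insert col (Finset.notMem_erase y Y)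
  rw [Finset.insert_erase hy] at h
  rw [h, add_tsub_cancel_right]

theorem exists_mem_notMem_of_nu_lt (col : ι → Fin m) {Y Z : Finset ι} {j : Fin m}
    (h : nu col Z j < nu col Y j) : ∃ y ∈ Y, y ∉ Z ∧ col y = j := by
  obtain ⟨y, hyY, hyZ⟩ := Finset.exists_mem_notMem_of_card_lt_card h
  grind

/-- Symmetric exchange for feasible sets of contracts. -/
theorem feasible_exchange {F : Set (Fin m → ℕ)} (hM : MNatConvex F) (col : ι → Fin m)
    {Y Z : Finset ι} (hY : nu col Y ∈ F) (hZ : nu col Z ∈ F) {x : ι} (hxZ : x ∈ Z)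
    (hxY : x ∉ Y) :
    nu col (insert x Y) ∈ F ∨ ∃ y ∈ Y, y ∉ Z ∧
      nu col ((insert x Y).erase y) ∈ F ∧ nu col (insert y (Z.erase x)) ∈ F := by
  have hswap : ∀ y ∈ Y, y ∉ Z →
      nu col ((insert x Y).erase y) = nu col Y + chi (col x) - chi (col y) ∧
      nu col (insert y (Z.erase x)) = nu col Z - chi (col x) + chi (col y) := by
    intro y hyY hyZ
    rw [nu_erase col (Finset.mem_insert_of_mem hyY), nu_insert col hxY,
      nu_insert col (fun hy => hyZ (Finset.mem_of_mem_erase hy)), nu_erase col hxZ]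
    exact ⟨rfl, rfl⟩
  by_cases hlt : nu col Y (col x) < nu col Z (col x)
  · obtain ⟨-, hf⟩ | ⟨j, hj, hfZ, hfY⟩ := hM _ hZ _ hY _ hlt
    · exact Or.inl (nu_insert col hxY ▸ hf)
    · obtain ⟨y, hyY, hyZ, rfl⟩ := exists_mem_notMem_of_nu_lt col hj
      obtain ⟨h₁, h₂⟩ := hswap y hyY hyZ
      exact Or.inr ⟨y, hyY, hyZ, h₁ ▸ hfY, h₂ ▸ hfZ⟩
  · have hErase : nu col (Z.erase x) (col x) < nu col Y (col x) := by
      have hZx := congrFun (nu_insert col (Finset.notMem_erase x Z)) (col x)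
      rw [Finset.insert_erase hxZ] at hZx
      simp only [Pi.add_apply, chi, if_true] at hZx
      omega
    obtain ⟨y, hyY, hyE, hcol⟩ := exists_mem_notMem_of_nu_lt col hErase
    have hyZ : y ∉ Z := fun hy =>
      hyE (Finset.mem_erase.2 ⟨fun e => hxY (e ▸ hyY), hy⟩)
    obtain ⟨h₁, h₂⟩ := hswap y hyY hyZ
    refine Or.inr ⟨y, hyY, hyZ, ?_, ?_⟩
    · rwa [h₁, hcol, add_tsub_cancel_right]
    · rwa [h₂, hcol, ← nu_erase col hxZ, ← nu_insert col (Finset.notMem_erase x Z),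
        Finset.insert_erase hxZ]

end Feasibility

/-- Lemma 6, local optimality: Let `F` be a hereditary M♮-convex set,
`X` a finite set of contracts (the type `ι`) with colleges `col : ι → Fin m`, and
`w` an injective positive weight. For `Y' ⊆ X'` feasible, `Y'` is a maximum-weight
feasible subset of `X'` iff for each `x ∈ X' \ Y'`, (a) `Y' ∪ {x}` is infeasible, and
(b) for every `y ∈ Y'`, if `(Y' ∪ {x}) \ {y}` is feasible then `w y > w x`. -/
theorem local_optimality {m : ℕ} (F : Set (Fin m → ℕ)) (hF : Hereditary F)
    (hM : MNatConvex F) {ι : Type*} [Fintype ι] [DecidableEq ι] (col : ι → Fin m)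
    (w : ι → ℝ) (hwinj : Function.Injective w) (hwpos : ∀ x : ι, 0 < w x)
    (X' Y' : Finset ι) (hYX : Y' ⊆ X') (hYfeas : nu col Y' ∈ F) :
    (∀ Z ⊆ X', nu col Z ∈ F → ∑ x ∈ Z, w x ≤ ∑ x ∈ Y', w x) ↔
      (∀ x ∈ X' \ Y',
        nu col (insert x Y') ∉ F ∧
        ∀ y ∈ Y', nu col ((insert x Y').erase y) ∈ F → w x < w y) := by
  constructor
  · intro h x hx
    obtain ⟨hxX, hxY⟩ := Finset.mem_sdiff.1 hx
    have hsub : insert x Y' ⊆ X' := Finset.insert_subset hxX hYX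
    refine ⟨fun hf => ?_, fun y hy hf => ?_⟩
    · have := h _ hsub hf
      rw [Finset.sum_insert hxY] at this
      linarith [hwpos x]
    · have hle := h _ ((Finset.erase_subset _ _).trans hsub) hf
      have hsum := Finset.add_sum_erase (insert x Y') w (Finset.mem_insert_of_mem hy)
      rw [Finset.sum_insert hxY] at hsum
      have hne : w x ≠ w y := fun e => hxY (hwinj e ▸ hy)
      exact lt_of_le_of_ne (by linarith) hne
  · intro h Z
    induction hn : (Z \ Y').card using Nat.strong_induction_on generalizing Z with
    | _ n ih =>
      intro hZX hZ
      by_cases hZY : Z ⊆ Y'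
      · exact Finset.sum_le_sum_of_subset_of_nonneg hZY fun x _ _ => (hwpos x).le
      · obtain ⟨x, hxZ, hxY⟩ := Finset.not_subset.1 hZY
        obtain ⟨ha, hb⟩ := h x (Finset.mem_sdiff.2 ⟨hZX hxZ, hxY⟩)
        obtain hf | ⟨y, hyY, hyZ, hfY, hfZ⟩ :=
          feasible_exchange hM col hYfeas hZ hxZ hxY
        · exact absurd hf ha
        have hyE : y ∉ Z.erase x := fun hy => hyZ (Finset.mem_of_mem_erase hy)
        have hlt := hb y hyY hfY
        have hcard : (insert y (Z.erase x) \ Y').card < n := by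
          rw [← hn]
          refine Finset.card_lt_card (Finset.ssubset_iff_of_subset ?_ |>.2
            ⟨x, Finset.mem_sdiff.2 ⟨hxZ, hxY⟩, ?_⟩)
          · intro z hz
            grind
          · grind
        have hle := ih _ hcard _ rfl
          (Finset.insert_subset (hYX hyY) ((Finset.erase_subset _ _).trans hZX)) hfZ
        rw [Finset.sum_insert hyE] at hle
        linarith [Finset.add_sum_erase Z w hxZ]
end

section
/- Let F ⊆ (Fin m → ℕ) be hereditary and an M♮-convex set, and let v¹, v², …, vᵗ be a sequence of vectors such that: (1) vᵏ ∈ F for each k ∈ {1,…,t}; and (2) for each k ∈ {1,…,t−1} there exist indices k₁ ≠ k₂ with v^{k+1} = vᵏ + χ_{k₁} − χ_{k₂} and vᵏ + χ_{k₁} ∉ F. Then for each k ∈ {1,…,t−1} and each index ℓ, if v^{k+1} + χ_ℓ ∈ F, then vᵏ + χ_ℓ ∈ F. -/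
/-- One exchange step: if `v + χ_a ∉ F`, then every unit that can be added to `v + χ_a - χ_b`
can also be added to `v`. -/
theorem MNatConvex.add_chi_mem_of_exchange {m : ℕ} {F : Set (Fin m → ℕ)} (hM : MNatConvex F)
    {v : Fin m → ℕ} (hv : v ∈ F) {a b ℓ : Fin m} (hab : a ≠ b) (ha : v + chi a ∉ F)
    (hu : v + chi a - chi b + chi ℓ ∈ F) : v + chi ℓ ∈ F := by
  have hlt : v a < (v + chi a - chi b + chi ℓ) a := by
    simp [chi, hab]
    omega
  rcases hM _ hu v hv a hlt with ⟨_, h⟩ | ⟨j, hj, h, _⟩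
  · exact absurd h ha
  · simp only [chi, Pi.add_apply, Pi.sub_apply] at hj
    obtain rfl : j = b := by
      by_contra hjb
      simp only [hjb, if_false] at hj
      omega
    convert h using 1
    funext x
    by_cases hx : x = j
    · subst hx
      simp only [chi, Pi.add_apply, Pi.sub_apply, if_true, if_neg hab.symm] at hj ⊢
      omega
    · simp only [chi, Pi.add_apply, Pi.sub_apply, if_neg hx]
      omega

/-- Lemma 5 in the paper: Let `F` be a hereditary M♮-convex set and
`v¹, …, vᵗ` a sequence in `F` such that each step adds one unit at some coordinate `k₁`
and removes one unit at a different coordinate `k₂`, where `vᵏ + χ_{k₁} ∉ F`.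
Then for each `k ∈ {1,…,t−1}` and each index `ℓ`, if `v^{k+1} + χ_ℓ ∈ F`
then `vᵏ + χ_ℓ ∈ F`. -/
theorem sequence_lemma {m : ℕ} (F : Set (Fin m → ℕ)) (hF : Hereditary F) (hM : MNatConvex F)
    (t : ℕ) (v : ℕ → (Fin m → ℕ))
    (h1 : ∀ k, 1 ≤ k → k ≤ t → v k ∈ F)
    (h2 : ∀ k, 1 ≤ k → k ≤ t - 1 → ∃ k₁ k₂ : Fin m, k₁ ≠ k₂ ∧
      v (k + 1) = v k + chi k₁ - chi k₂ ∧ v k + chi k₁ ∉ F) :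
    ∀ k, 1 ≤ k → k ≤ t - 1 → ∀ ℓ : Fin m, v (k + 1) + chi ℓ ∈ F → v k + chi ℓ ∈ F := by
  intro k hk hkt ℓ hℓ
  obtain ⟨a, b, hab, hstep, ha⟩ := h2 k hk hkt
  rw [hstep] at hℓ
  exact hM.add_chi_mem_of_exchange (h1 k hk (by omega)) hab ha hℓ
end

section
/- In a matching market whose constraint family F ⊆ ℕ^m is hereditary and an M♮-convex set, every HM-stable matching Y is weakly nonwasteful: no student strongly claims an empty seat, i.e., there is no student s and college c such that (s,c) ∈ X is acceptable for s, (s,c) ≻_s Y_s, and Y ∪ {(s,c)} is feasible. -/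
open scoped Classical

/-- The vector counting, for each college, the number of contracts in `Y` involving it. -/
noncomputable def nuC {S : Type*} {m : ℕ} (Y : Finset (S × Fin m)) : Fin m → ℕ :=
  fun c => (Y.filter (fun x => x.2 = c)).card

/-- `Y` is a matching: `Y ⊆ X`, each student has at most one contract in `Y`, and
every contract in `Y` is acceptable to its student (`prefS s (some c) none` means
student `s` strictly prefers college `c` to her outside option). -/
def IsMatching {S : Type*} {m : ℕ}
    (prefS : S → Option (Fin m) → Option (Fin m) → Prop)
    (X Y : Finset (S × Fin m)) : Prop :=
  Y ⊆ X ∧ (∀ s : S, (Y.filter (fun x => x.1 = s)).card ≤ 1) ∧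
    ∀ x ∈ Y, prefS x.1 (some x.2) none

/-- `(s, c) ≻_s Y_s`: contract `(s, c)` is acceptable for `s` and `s` strictly prefers
it to her assignment in `Y` (if any). -/
def PrefersOver {S : Type*} {m : ℕ}
    (prefS : S → Option (Fin m) → Option (Fin m) → Prop)
    (Y : Finset (S × Fin m)) (s : S) (c : Fin m) : Prop :=
  prefS s (some c) none ∧ ∀ c' : Fin m, (s, c') ∈ Y → prefS s (some c) (some c')

/-- The students' choice function: each student keeps her most preferred acceptable
contract in `Z`, if any. -/
noncomputable def ChS {S : Type*} {m : ℕ}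
    (prefS : S → Option (Fin m) → Option (Fin m) → Prop)
    (Z : Finset (S × Fin m)) : Finset (S × Fin m) :=
  Z.filter (fun x => prefS x.1 (some x.2) none ∧
    ∀ x' ∈ Z, x'.1 = x.1 → x' ≠ x → prefS x'.1 (some x'.2) none →
      prefS x.1 (some x.2) (some x'.2))

/-- `Z'` is an optimal choice from `Z`: it is a feasible subset of `Z` of maximum
total weight among feasible subsets of `Z`. -/
def OptimalChoice {S : Type*} {m : ℕ} (F : Set (Fin m → ℕ)) (w : S × Fin m → ℝ)
    (Z Z' : Finset (S × Fin m)) : Prop :=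
  Z' ⊆ Z ∧ nuC Z' ∈ F ∧ ∀ Z'' ⊆ Z, nuC Z'' ∈ F → ∑ x ∈ Z'', w x ≤ ∑ x ∈ Z', w x

/-- `Y` is HM-stable: `Y = Ch_S(Y)`, `Y` is feasible, and no contract `x ∈ X \ Y` is
chosen both by the students' choice from `Y ∪ {x}` and by some optimal (colleges')
choice from `Y ∪ {x}`. -/
noncomputable def HMStable {S : Type*} {m : ℕ} (F : Set (Fin m → ℕ)) (w : S × Fin m → ℝ)
    (prefS : S → Option (Fin m) → Option (Fin m) → Prop)
    (X Y : Finset (S × Fin m)) : Prop :=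
  ChS prefS Y = Y ∧ nuC Y ∈ F ∧
    ¬∃ x ∈ X, x ∉ Y ∧ x ∈ ChS prefS (insert x Y) ∧
      ∃ Z' : Finset (S × Fin m), OptimalChoice F w (insert x Y) Z' ∧ x ∈ Z'

/-- In a matching market whose constraint family is a hereditary
M♮-convex set, every HM-stable matching is weakly nonwasteful: no student strongly
claims an empty seat. -/
theorem hm_stable_weakly_nonwasteful {S : Type*} [Fintype S] {m : ℕ}
    (F : Set (Fin m → ℕ)) (hF : Hereditary F) (hM : MNatConvex F)
    (X : Finset (S × Fin m))
    (prefS : S → Option (Fin m) → Option (Fin m) → Prop)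
    (hprefS : ∀ s : S, IsStrictTotalOrder (Option (Fin m)) (prefS s))
    (prefC : Fin m → S → S → Prop)
    (hprefC : ∀ c : Fin m, IsStrictTotalOrder S (prefC c))
    (w : S × Fin m → ℝ) (hwinj : Set.InjOn w ↑X) (hwpos : ∀ x ∈ X, 0 < w x)
    (hwresp : ∀ (s s' : S) (c : Fin m), (s, c) ∈ X → (s', c) ∈ X →
      prefC c s s' → w (s', c) < w (s, c))
    (Y : Finset (S × Fin m)) (hY : IsMatching prefS X Y)
    (hstable : HMStable F w prefS X Y) :
    ¬∃ (s : S) (c : Fin m), (s, c) ∈ X ∧ PrefersOver prefS Y s c ∧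
      nuC (insert (s, c) Y) ∈ F := by
  rintro ⟨s, c, hX, ⟨hacc, hpref⟩, hfeas⟩
  obtain ⟨-, -, hblock⟩ := hstable
  have hnot : (s, c) ∉ Y := fun h =>
    (hprefS s).toIsStrictOrder.toIrrefl.irrefl _ (hpref c h)
  refine hblock ⟨(s, c), hX, hnot, ?_, insert (s, c) Y, ⟨subset_rfl, hfeas, ?_⟩,
    Finset.mem_insert_self _ _⟩
  · simp only [ChS, Finset.mem_filter]
    refine ⟨Finset.mem_insert_self _ _, hacc, ?_⟩
    rintro ⟨s', c'⟩ hmem rfl hne -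
    exact hpref c' (Finset.mem_of_mem_insert_of_ne hmem hne)
  · intro Z hZ _
    refine Finset.sum_le_sum_of_subset_of_nonneg hZ fun x hx _ => (hwpos x ?_).le
    exact Finset.insert_subset hX hY.1 hx
end

section
/- In a matching market whose constraint family F ⊆ ℕ^m is hereditary and an M♮-convex set, every HM-stable matching Y is fair in terms of generalized justified envy: there are no students s, s' (possibly equal) and contracts (s,c) ∈ X \ Y, (s',c') ∈ Y such that (s,c) is acceptable for s, (s,c) ≻_s Y_s, w((s,c)) > w((s',c')), and (Y \ {(s',c')}) ∪ {(s,c)} is feasible. -/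
open scoped Classical

/-- If `∅` is feasible, every finite set of contracts has an optimal choice. -/
theorem exists_optimalChoice {S : Type*} {m : ℕ} (F : Set (Fin m → ℕ)) (h0 : 0 ∈ F)
    (w : S × Fin m → ℝ) (Z : Finset (S × Fin m)) : ∃ Z', OptimalChoice F w Z Z' := by
  have hne : (Z.powerset.filter (fun T => nuC T ∈ F)).Nonempty := by
    refine ⟨∅, Finset.mem_filter.2 ⟨Finset.empty_mem_powerset Z, ?_⟩⟩
    have h : nuC (∅ : Finset (S × Fin m)) = 0 := by
      funext c
      simp [nuC]
    rwa [h]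
  obtain ⟨Z', hZ', hmax⟩ := Finset.exists_max_image _ (fun T => ∑ x ∈ T, w x) hne
  rw [Finset.mem_filter, Finset.mem_powerset] at hZ'
  exact ⟨Z', hZ'.1, hZ'.2, fun T hT hTF =>
    hmax T (Finset.mem_filter.2 ⟨Finset.mem_powerset.2 hT, hTF⟩)⟩

/-- A contract which its student prefers to her assignment in `Y` is chosen by the students
from `Y` together with that contract. -/
theorem PrefersOver.mem_chS_insert {S : Type*} {m : ℕ}
    {prefS : S → Option (Fin m) → Option (Fin m) → Prop} {Y : Finset (S × Fin m)}
    {s : S} {c : Fin m} (h : PrefersOver prefS Y s c) :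
    (s, c) ∈ ChS prefS (insert (s, c) Y) := by
  refine Finset.mem_filter.2 ⟨Finset.mem_insert_self _ _, h.1, ?_⟩
  rintro ⟨t, d⟩ hmem rfl hne -
  exact h.2 d ((Finset.mem_insert.1 hmem).resolve_left hne)

/-- In a matching market whose constraint family is a hereditary
M♮-convex set, every HM-stable matching is fair in terms of generalized justified
envy: there are no students `s, s'` (possibly equal) and contracts `(s,c) ∈ X \ Y`,
`(s',c') ∈ Y` with `(s,c) ≻_s Y_s`, `w (s,c) > w (s',c')`, and
`(Y \ {(s',c')}) ∪ {(s,c)}` feasible. -/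
theorem hm_stable_no_generalized_envy {S : Type*} [Fintype S] {m : ℕ}
    (F : Set (Fin m → ℕ)) (hF : Hereditary F) (hM : MNatConvex F)
    (X : Finset (S × Fin m))
    (prefS : S → Option (Fin m) → Option (Fin m) → Prop)
    (hprefS : ∀ s : S, IsStrictTotalOrder (Option (Fin m)) (prefS s))
    (prefC : Fin m → S → S → Prop)
    (hprefC : ∀ c : Fin m, IsStrictTotalOrder S (prefC c))
    (w : S × Fin m → ℝ) (hwinj : Set.InjOn w ↑X) (hwpos : ∀ x ∈ X, 0 < w x)
    (hwresp : ∀ (s s' : S) (c : Fin m), (s, c) ∈ X → (s', c) ∈ X →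
      prefC c s s' → w (s', c) < w (s, c))
    (Y : Finset (S × Fin m)) (hY : IsMatching prefS X Y)
    (hstable : HMStable F w prefS X Y) :
    ¬∃ (s s' : S) (c c' : Fin m),
      (s, c) ∈ X ∧ (s, c) ∉ Y ∧ (s', c') ∈ Y ∧ PrefersOver prefS Y s c ∧
      w (s', c') < w (s, c) ∧ nuC (insert (s, c) (Y.erase (s', c'))) ∈ F := by
  rintro ⟨s, s', c, c', hX, hnY, hY', hpref, hlt, hfeas⟩
  obtain ⟨Z', hZ'⟩ := exists_optimalChoice F hF.1 w (insert (s, c) Y)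
  refine hstable.2.2 ⟨(s, c), hX, hnY, hpref.mem_chS_insert, Z', hZ', ?_⟩
  by_contra hnZ
  have hsub : Z' ⊆ Y := (Finset.subset_insert_iff_of_notMem hnZ).1 hZ'.1
  have hle : ∑ x ∈ Z', w x ≤ ∑ x ∈ Y, w x :=
    Finset.sum_le_sum_of_subset_of_nonneg hsub fun x hx _ => (hwpos x (hY.1 hx)).le
  have hswap := hZ'.2.2 _ (Finset.insert_subset_insert _ (Finset.erase_subset (s', c') Y)) hfeas
  rw [Finset.sum_insert fun h => hnY (Finset.mem_of_mem_erase h)] at hswap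
  have hsum := Finset.add_sum_erase Y w hY'
  linarith
end

section
/- Let F ⊆ (Fin m → ℕ) be hereditary, and for d ∈ ℕ let F^d = {ν ∈ F : |ν| ≤ d}. If F^d is an M♮-convex set, then for every d' with 0 < d' < d, the family F^{d'} is also an M♮-convex set. -/
theorem sum_chi {m : ℕ} (i : Fin m) : ∑ k, chi i k = 1 := by
  simp [chi]

theorem sum_add_chi {m : ℕ} (ν : Fin m → ℕ) (i : Fin m) :
    ∑ k, (ν + chi i) k = ∑ k, ν k + 1 := by
  simp only [Pi.add_apply, Finset.sum_add_distrib, sum_chi]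

theorem sub_chi_add_chi {m : ℕ} {ν : Fin m → ℕ} {i : Fin m} (h : 0 < ν i) :
    ν - chi i + chi i = ν := by
  funext k
  by_cases hk : k = i
  · subst hk
    simp only [Pi.add_apply, Pi.sub_apply, chi, if_true]
    omega
  · simp [chi, hk]

theorem sum_sub_chi {m : ℕ} {ν : Fin m → ℕ} {i : Fin m} (h : 0 < ν i) :
    ∑ k, (ν - chi i) k + 1 = ∑ k, ν k := by
  rw [← sum_add_chi, sub_chi_add_chi h]

/-- The augmentation property of M♮-convex sets: a member can be increased towards any member
of larger size. -/
theorem MNatConvex.exists_add_chi_mem {m : ℕ} {G : Set (Fin m → ℕ)} (hG : MNatConvex G)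
    {x y : Fin m → ℕ} (hx : x ∈ G) (hy : y ∈ G) (hlt : ∑ k, x k < ∑ k, y k) :
    ∃ j, x j < y j ∧ x + chi j ∈ G := by
  induction h : ∑ k, (y k - x k) using Nat.strong_induction_on generalizing y with
  | _ n ih =>
    obtain ⟨j, -, hj⟩ := Finset.exists_lt_of_sum_lt hlt
    rcases hG y hy x hx j hj with ⟨-, hxj⟩ | ⟨k, hk, hy', -⟩
    · exact ⟨j, hj, hxj⟩
    have hle : ∀ l, (y - chi j + chi k) l - x l ≤ y l - x l := by
      intro l
      simp only [Pi.add_apply, Pi.sub_apply, chi]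
      split_ifs with h₁ h₂ <;> subst_vars <;> omega
    have hjk : j ≠ k := by
      rintro rfl
      omega
    have hdec : ∑ l, ((y - chi j + chi k) l - x l) < n := by
      rw [← h]
      refine Finset.sum_lt_sum (fun l _ => hle l) ⟨j, Finset.mem_univ j, ?_⟩
      simp only [Pi.add_apply, Pi.sub_apply, chi, if_true, if_neg hjk]
      omega
    have hsum : ∑ l, x l < ∑ l, (y - chi j + chi k) l := by
      rw [sum_add_chi, sum_sub_chi (by omega)]
      exact hlt
    obtain ⟨l, hl, hxl⟩ := ih _ hdec hy' hsum rfl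
    have := hle l
    exact ⟨l, by omega, hxl⟩

/-- If `F ⊆ ℕ^m` is hereditary and its truncation `F^d = {ν ∈ F : |ν| ≤ d}`
is M♮-convex, then `F^{d'}` is also M♮-convex for every `0 < d' < d`. -/
theorem truncation_smaller_mnat_convex {m : ℕ} (F : Set (Fin m → ℕ)) (hF : Hereditary F)
    (d : ℕ) (hd : MNatConvex {ν ∈ F | ∑ i, ν i ≤ d}) :
    ∀ d' : ℕ, 0 < d' → d' < d → MNatConvex {ν ∈ F | ∑ i, ν i ≤ d'} := by
  rintro d' - hdd ν ⟨hν, hνd⟩ ν' ⟨hν', hνd'⟩ i hi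
  have hsub := sum_sub_chi (ν := ν) (i := i) (by omega)
  have hsub_mem : ν - chi i ∈ F := hF.2 ν hν _ tsub_le_self
  have exchange_sums : ∀ j, ν j < ν' j → ∑ k, (ν - chi i + chi j) k ≤ d' ∧
      ∑ k, (ν' + chi i - chi j) k ≤ d' := by
    intro j hj
    have h₁ := sum_sub_chi (ν := ν' + chi i) (i := j) (by simp only [Pi.add_apply]; omega)
    rw [sum_add_chi] at h₁ ⊢
    omega
  rcases hd ν ⟨hν, by omega⟩ ν' ⟨hν', by omega⟩ i hi with ⟨-, h, -⟩ | ⟨j, hj, ⟨h₁, -⟩, h₂, -⟩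
  · by_cases hlt : ∑ k, ν' k < d'
    · exact Or.inl ⟨⟨hsub_mem, by omega⟩, h, by rw [sum_add_chi]; omega⟩
    obtain ⟨j, hj, hjF, -⟩ := hd.exists_add_chi_mem (x := ν - chi i) (y := ν')
      ⟨hsub_mem, by omega⟩ ⟨hν', by omega⟩ (by omega)
    have hj' : ν j < ν' j := by
      simp only [Pi.sub_apply, chi] at hj
      split_ifs at hj <;> subst_vars <;> omega
    exact Or.inr ⟨j, hj', ⟨hjF, (exchange_sums j hj').1⟩, hF.2 _ h _ tsub_le_self,
      (exchange_sums j hj').2⟩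
  · exact Or.inr ⟨j, hj, ⟨h₁, (exchange_sums j hj).1⟩, h₂, (exchange_sums j hj).2⟩
end

section
/- In a matching market (with weights respecting colleges' preferences), let Y be a feasible matching and suppose student s has justified envy toward student s' in Y: there is a college c with (s,c) ∈ X acceptable for s, (s,c) ≻_s Y_s, (s',c) ∈ Y, and (s,c) ≻_c (s',c). Then s has generalized justified envy toward s' in Y: there exist (s,c) ∈ X \ Y and (s',c') ∈ Y with (s,c) acceptable for s, (s,c) ≻_s Y_s, w((s,c)) > w((s',c')), and (Y \ {(s',c')}) ∪ {(s,c)} feasible. Consequently, every feasible matching that is fair in terms of generalized justified envy is fair. -/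
open scoped Classical

/-- Replacing a contract by another one with the same college keeps the college counts. -/
theorem nuC_insert_erase_of_mem {S : Type*} {m : ℕ} {Y : Finset (S × Fin m)} {s s' : S}
    {c : Fin m} (hs : (s, c) ∉ Y) (hs' : (s', c) ∈ Y) :
    nuC (insert (s, c) (Y.erase (s', c))) = nuC Y := by
  funext d
  unfold nuC
  rw [Finset.filter_insert, Finset.filter_erase]
  split_ifs with h
  · have hmem : (s', c) ∈ Y.filter (fun x => x.2 = d) := Finset.mem_filter.2 ⟨hs', h⟩
    rw [Finset.card_insert_of_notMem (by simp [hs]), Finset.card_erase_add_one hmem]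
  · rw [Finset.erase_eq_of_notMem (by simp_all)]

/-- In a matching market with weights respecting colleges' preferences,
if in a feasible matching `Y` a student `s` has justified envy toward `s'`
(at some college `c`), then `s` has generalized justified envy toward `s'`;
consequently, every feasible matching that is fair in terms of generalized justified
envy is fair. -/
theorem justified_envy_implies_generalized {S : Type*} [Fintype S] {m : ℕ}
    (F : Set (Fin m → ℕ))
    (X : Finset (S × Fin m))
    (prefS : S → Option (Fin m) → Option (Fin m) → Prop)
    (hprefS : ∀ s : S, IsStrictTotalOrder (Option (Fin m)) (prefS s))
    (prefC : Fin m → S → S → Prop)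
    (hprefC : ∀ c : Fin m, IsStrictTotalOrder S (prefC c))
    (w : S × Fin m → ℝ) (hwinj : Set.InjOn w ↑X) (hwpos : ∀ x ∈ X, 0 < w x)
    (hwresp : ∀ (s s' : S) (c : Fin m), (s, c) ∈ X → (s', c) ∈ X →
      prefC c s s' → w (s', c) < w (s, c))
    (Y : Finset (S × Fin m)) (hY : IsMatching prefS X Y) (hYfeas : nuC Y ∈ F) :
    (∀ (s s' : S) (c : Fin m), (s, c) ∈ X → PrefersOver prefS Y s c →
        (s', c) ∈ Y → prefC c s s' →
        ∃ (c₀ c' : Fin m), (s, c₀) ∈ X ∧ (s, c₀) ∉ Y ∧ (s', c') ∈ Y ∧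
          PrefersOver prefS Y s c₀ ∧ w (s', c') < w (s, c₀) ∧
          nuC (insert (s, c₀) (Y.erase (s', c'))) ∈ F) ∧
    ((¬∃ (s s' : S) (c₀ c' : Fin m), (s, c₀) ∈ X ∧ (s, c₀) ∉ Y ∧ (s', c') ∈ Y ∧
        PrefersOver prefS Y s c₀ ∧ w (s', c') < w (s, c₀) ∧
        nuC (insert (s, c₀) (Y.erase (s', c'))) ∈ F) →
      ¬∃ (s s' : S) (c : Fin m), (s, c) ∈ X ∧ PrefersOver prefS Y s c ∧
        (s', c) ∈ Y ∧ prefC c s s') := by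
  have envy : ∀ (s s' : S) (c : Fin m), (s, c) ∈ X → PrefersOver prefS Y s c →
      (s', c) ∈ Y → prefC c s s' →
      ∃ (c₀ c' : Fin m), (s, c₀) ∈ X ∧ (s, c₀) ∉ Y ∧ (s', c') ∈ Y ∧
        PrefersOver prefS Y s c₀ ∧ w (s', c') < w (s, c₀) ∧
        nuC (insert (s, c₀) (Y.erase (s', c'))) ∈ F := by
    intro s s' c hX hpref hs' hc
    have hs : (s, c) ∉ Y := fun h => (hprefS s).irrefl _ (hpref.2 c h)
    refine ⟨c, c, hX, hs, hs', hpref, hwresp s s' c hX (hY.1 hs') hc, ?_⟩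
    rwa [nuC_insert_erase_of_mem hs hs']
  refine ⟨envy, ?_⟩
  rintro hfair ⟨s, s', c, hX, hpref, hs', hc⟩
  exact hfair ⟨s, s', envy s s' c hX hpref hs' hc⟩
end
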